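/- arXiv:2010.06851 — 2 statements merged into one kernel-verified Lean document; each statement's English description precedes it below -/
import Mathlib

section
/- Let α ∈ (1,2] and define ψ₁(x) = min(|x|, 1)·sign(x). Then for every x ∈ ℝ, 1 − x + |x|^α > 0, 1 + x + |x|^α > 0, and −log(1 − x + |x|^α) ≤ ψ₁(x) ≤ log(1 + x + |x|^α). -/
/-- The truncation function `ψ_τ(x) = min(|x|, τ) · sign(x)`. -/
noncomputable def psiTrunc (τ x : ℝ) : ℝ := min |x| τ * Real.sign x

theorem psiTrunc_neg (τ x : ℝ) : psiTrunc τ (-x) = -psiTrunc τ x := by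
  simp [psiTrunc, Real.sign_neg]

theorem psiTrunc_of_abs_le {τ x : ℝ} (hx : |x| ≤ τ) : psiTrunc τ x = x := by
  rw [psiTrunc, min_eq_left hx]
  rcases lt_trichotomy x 0 with h | rfl | h
  · rw [Real.sign_of_neg h, abs_of_neg h]; ring
  · simp
  · rw [Real.sign_of_pos h, abs_of_pos h, mul_one]

theorem exp_psiTrunc_one_le {α : ℝ} (hα1 : 1 < α) (hα2 : α ≤ 2) (x : ℝ) :
    Real.exp (psiTrunc 1 x) ≤ 1 + x + |x| ^ α := by
  rcases le_or_gt |x| 1 with hx | hx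
  · rw [psiTrunc_of_abs_le hx]
    have hpow : x ^ 2 ≤ |x| ^ α := by
      rw [← sq_abs, ← Real.rpow_two]
      exact Real.rpow_le_rpow_of_exponent_ge_of_imp (abs_nonneg x) hx hα2
        fun _ h => absurd h (by linarith)
    linarith [(abs_le.mp (Real.abs_exp_sub_one_sub_id_le hx)).2]
  · have hpow : |x| ≤ |x| ^ α := Real.self_le_rpow_of_one_le hx.le hα1.le
    rw [psiTrunc, min_eq_right hx.le, one_mul]
    rcases lt_abs.mp hx with h | h
    · rw [Real.sign_of_pos (by linarith)]
      linarith [Real.exp_one_lt_d9]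
    · rw [Real.sign_of_neg (by linarith)]
      have hexp : Real.exp (-1) ≤ 1 := Real.exp_le_one_iff.mpr (by norm_num)
      linarith [neg_abs_le x]

/-- For `α ∈ (1,2]` and `ψ₁(x) = min(|x|,1)·sign(x)`, one has
`1 − x + |x|^α > 0`, `1 + x + |x|^α > 0`, and
`−log(1 − x + |x|^α) ≤ ψ₁(x) ≤ log(1 + x + |x|^α)` for every real `x`. -/
theorem psiTrunc_one_log_sandwich (α : ℝ) (hα1 : 1 < α) (hα2 : α ≤ 2) (x : ℝ) :
    0 < 1 - x + |x| ^ α ∧ 0 < 1 + x + |x| ^ α ∧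
      -Real.log (1 - x + |x| ^ α) ≤ psiTrunc 1 x ∧
      psiTrunc 1 x ≤ Real.log (1 + x + |x| ^ α) := by
  have hpos := exp_psiTrunc_one_le hα1 hα2 x
  have hneg := exp_psiTrunc_one_le hα1 hα2 (-x)
  rw [psiTrunc_neg, abs_neg, ← sub_eq_add_neg] at hneg
  have hpos' := (Real.exp_pos _).trans_le hpos
  have hneg' := (Real.exp_pos _).trans_le hneg
  exact ⟨hneg', hpos', neg_le.mp ((Real.le_log_iff_exp_le hneg').mpr hneg),
    (Real.le_log_iff_exp_le hpos').mpr hpos⟩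
end

section
/- Let X be a random vector in ℝ^d with E[‖X‖₂⁶] < ∞ and E[⟨v, X⟩⁶] ≤ R′ for every unit vector v ∈ ℝ^d. Then for every unit vector v ∈ ℝ^d and every τ > 0, E[ ⟨v, X⟩² · 1{‖X‖₂² > τ} ] ≤ R′^{1/3} · ( E[‖X‖₂⁶] / τ³ )^{2/3}. In particular, the truncation bias of the truncated covariance estimator satisfies 0 ≤ E[ (1 − min(‖X‖₂², τ)/‖X‖₂²) ⟨v, X⟩² ] ≤ R′^{1/3} ( E[‖X‖₂⁶] / τ³ )^{2/3}. -/
open MeasureTheory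
open scoped ENNReal

/-- Euclidean (ℓ²) norm on `Fin d → ℝ`. -/
noncomputable def l2norm {d : ℕ} (x : Fin d → ℝ) : ℝ := Real.sqrt (∑ i, x i ^ 2)

lemma l2norm_sq {d : ℕ} (x : Fin d → ℝ) : l2norm x ^ 2 = ∑ i, x i ^ 2 :=
  Real.sq_sqrt (Finset.sum_nonneg fun _ _ => sq_nonneg _)

lemma measurable_l2norm {d : ℕ} : Measurable (l2norm : (Fin d → ℝ) → ℝ) := by
  unfold l2norm
  fun_prop

lemma sq_sum_mul_le_l2norm_sq {d : ℕ} (v x : Fin d → ℝ) :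
    (∑ j, v j * x j) ^ 2 ≤ l2norm v ^ 2 * l2norm x ^ 2 := by
  rw [l2norm_sq, l2norm_sq]
  exact Finset.sum_mul_sq_le_sq_mul_sq _ _ _

/-- Hölder's inequality with exponents `3` and `3 / 2`, one factor being an indicator. -/
lemma setIntegral_sq_le_rpow_mul_rpow {Ω : Type*} [MeasurableSpace Ω] {μ : Measure Ω}
    [IsFiniteMeasure μ] {Y : Ω → ℝ} (hY : Measurable Y) (hY6 : Integrable (fun ω => Y ω ^ 6) μ)
    {s : Set Ω} (hs : MeasurableSet s) :
    ∫ ω in s, Y ω ^ 2 ∂μ ≤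
      (∫ ω, Y ω ^ 6 ∂μ) ^ ((1 : ℝ) / 3) * μ.real s ^ ((2 : ℝ) / 3) := by
  have hpq : (3 : ℝ).HolderConjugate (3 / 2) := by
    rw [Real.holderConjugate_iff]; norm_num
  have hpow : ∀ ω, (Y ω ^ 2) ^ (3 : ℝ) = Y ω ^ 6 := fun ω => by
    rw [show (3 : ℝ) = ((3 : ℕ) : ℝ) by norm_num, Real.rpow_natCast]; ring
  have hf : MemLp (fun ω => Y ω ^ 2) (ENNReal.ofReal 3) μ := by
    rw [← integrable_norm_rpow_iff (by fun_prop) (by simp) (by simp)]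
    refine hY6.congr (Filter.Eventually.of_forall fun ω => ?_)
    simp only [ENNReal.toReal_ofReal (show (0 : ℝ) ≤ 3 by norm_num),
      Real.norm_of_nonneg (sq_nonneg (Y ω)), hpow]
  have hg : MemLp (s.indicator fun _ => (1 : ℝ)) (ENNReal.ofReal (3 / 2)) μ :=
    (memLp_const 1).indicator hs
  have holder := integral_mul_le_Lp_mul_Lq_of_nonneg (μ := μ) hpq
    (Filter.Eventually.of_forall fun ω => sq_nonneg (Y ω))
    (Filter.Eventually.of_forall fun ω => Set.indicator_nonneg (fun _ _ => zero_le_one) ω) hf hg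
  have hind : ∀ ω, (s.indicator (fun _ => (1 : ℝ)) ω) ^ ((3 : ℝ) / 2) =
      s.indicator (fun _ => (1 : ℝ)) ω := fun ω => by
    by_cases h : ω ∈ s
    · simp [h]
    · simp [h, Real.zero_rpow (show (3 : ℝ) / 2 ≠ 0 by norm_num)]
  have hmul : ∀ ω, Y ω ^ 2 * s.indicator (fun _ => (1 : ℝ)) ω =
      s.indicator (fun ω => Y ω ^ 2) ω := fun ω => by
    by_cases h : ω ∈ s <;> simp [h]
  simp only [hpow, hind, hmul, integral_indicator hs] at holder
  simpa using holder

/-- Markov's inequality for the sixth moment. -/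
lemma measureReal_lt_sq_le {Ω : Type*} [MeasurableSpace Ω] {μ : Measure Ω}
    [IsFiniteMeasure μ] {N : Ω → ℝ} (hN6 : Integrable (fun ω => N ω ^ 6) μ)
    {τ : ℝ} (hτ : 0 < τ) :
    μ.real {ω | τ < N ω ^ 2} ≤ (∫ ω, N ω ^ 6 ∂μ) / τ ^ 3 := by
  rw [le_div_iff₀ (by positivity), mul_comm]
  refine le_trans ?_ (mul_meas_ge_le_integral_of_nonneg
    (Filter.Eventually.of_forall fun ω => (by positivity : (0 : ℝ) ≤ N ω ^ 6)) hN6 (τ ^ 3))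
  refine mul_le_mul_of_nonneg_left (measureReal_mono fun ω hω => ?_) (by positivity)
  calc τ ^ 3 ≤ (N ω ^ 2) ^ 3 := pow_le_pow_left₀ hτ.le (le_of_lt hω) 3
    _ = N ω ^ 6 := by ring

/-- Truncation-bias bound: if `E‖X‖₂⁶ < ∞` and `E⟨v,X⟩⁶ ≤ R′` for all unit `v`,
then for every unit vector `v` and every `τ > 0`,
`E[⟨v,X⟩² 1{‖X‖₂² > τ}] ≤ R′^{1/3} (E‖X‖₂⁶ / τ³)^{2/3}`, and the truncation bias
`E[(1 − min(‖X‖₂², τ)/‖X‖₂²) ⟨v,X⟩²]` lies between `0` and the same bound. -/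
theorem truncation_bias_bound
    {Ω : Type*} [MeasurableSpace Ω] (μ : Measure Ω) [IsProbabilityMeasure μ]
    {d : ℕ} (X : Ω → Fin d → ℝ) (hX : Measurable X)
    (hInt6 : Integrable (fun ω => l2norm (X ω) ^ 6) μ)
    (R' : ℝ) (hR' : 0 ≤ R')
    (h6 : ∀ v : Fin d → ℝ, l2norm v = 1 →
      ∫ ω, (∑ j, v j * X ω j) ^ 6 ∂μ ≤ R') :
    ∀ v : Fin d → ℝ, l2norm v = 1 → ∀ τ : ℝ, 0 < τ →
      (∫ ω, (if τ < l2norm (X ω) ^ 2 then (∑ j, v j * X ω j) ^ 2 else 0) ∂μ ≤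
        R' ^ ((1 : ℝ) / 3) * ((∫ ω, l2norm (X ω) ^ 6 ∂μ) / τ ^ 3) ^ ((2 : ℝ) / 3)) ∧
      (0 ≤ ∫ ω, (1 - min (l2norm (X ω) ^ 2) τ / l2norm (X ω) ^ 2) *
            (∑ j, v j * X ω j) ^ 2 ∂μ) ∧
      (∫ ω, (1 - min (l2norm (X ω) ^ 2) τ / l2norm (X ω) ^ 2) *
            (∑ j, v j * X ω j) ^ 2 ∂μ ≤
        R' ^ ((1 : ℝ) / 3) * ((∫ ω, l2norm (X ω) ^ 6 ∂μ) / τ ^ 3) ^ ((2 : ℝ) / 3)) := by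
  intro v hv τ hτ
  have hN : Measurable fun ω => l2norm (X ω) := measurable_l2norm.comp hX
  have hY : Measurable fun ω => ∑ j, v j * X ω j := by fun_prop
  have hle : ∀ ω, (∑ j, v j * X ω j) ^ 2 ≤ l2norm (X ω) ^ 2 := fun ω => by
    simpa [hv] using sq_sum_mul_le_l2norm_sq v (X ω)
  have hY6 : Integrable (fun ω => (∑ j, v j * X ω j) ^ 6) μ := by
    refine hInt6.mono' (by fun_prop) (Filter.Eventually.of_forall fun ω => ?_)
    rw [Real.norm_of_nonneg (by positivity)]
    calc (∑ j, v j * X ω j) ^ 6 = ((∑ j, v j * X ω j) ^ 2) ^ 3 := by ring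
      _ ≤ (l2norm (X ω) ^ 2) ^ 3 := pow_le_pow_left₀ (sq_nonneg _) (hle ω) 3
      _ = l2norm (X ω) ^ 6 := by ring
  have hs : MeasurableSet {ω | τ < l2norm (X ω) ^ 2} :=
    measurableSet_lt measurable_const (hN.pow_const 2)
  have hY2 : Integrable (fun ω => (∑ j, v j * X ω j) ^ 2) μ := by
    refine (hY6.add (integrable_const 1)).mono' (by fun_prop)
      (Filter.Eventually.of_forall fun ω => ?_)
    rw [Real.norm_of_nonneg (sq_nonneg _)]
    simp only [Pi.add_apply]
    nlinarith [sq_nonneg ((∑ j, v j * X ω j) ^ 2 - 1), sq_nonneg (∑ j, v j * X ω j),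
      mul_nonneg (sq_nonneg (∑ j, v j * X ω j)) (sq_nonneg ((∑ j, v j * X ω j) ^ 2 - 1))]
  have hind : (fun ω => if τ < l2norm (X ω) ^ 2 then (∑ j, v j * X ω j) ^ 2 else 0) =
      {ω | τ < l2norm (X ω) ^ 2}.indicator fun ω => (∑ j, v j * X ω j) ^ 2 := by
    ext ω
    simp [Set.indicator_apply]
  have htail : ∫ ω, (if τ < l2norm (X ω) ^ 2 then (∑ j, v j * X ω j) ^ 2 else 0) ∂μ ≤
      R' ^ ((1 : ℝ) / 3) * ((∫ ω, l2norm (X ω) ^ 6 ∂μ) / τ ^ 3) ^ ((2 : ℝ) / 3) := by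
    rw [hind, integral_indicator hs]
    refine (setIntegral_sq_le_rpow_mul_rpow hY hY6 hs).trans ?_
    have hY0 : 0 ≤ ∫ ω, (∑ j, v j * X ω j) ^ 6 ∂μ := integral_nonneg fun ω => by positivity
    have h6v := h6 v hv
    have hmarkov := measureReal_lt_sq_le hInt6 hτ
    gcongr
  have hweight : ∀ ω, 0 ≤ 1 - min (l2norm (X ω) ^ 2) τ / l2norm (X ω) ^ 2 := fun ω =>
    sub_nonneg.2 (div_le_one_of_le₀ (min_le_left _ _) (sq_nonneg _))
  have hnonneg : ∀ ω, 0 ≤ (1 - min (l2norm (X ω) ^ 2) τ / l2norm (X ω) ^ 2) *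
      (∑ j, v j * X ω j) ^ 2 := fun ω => mul_nonneg (hweight ω) (sq_nonneg _)
  refine ⟨htail, integral_nonneg hnonneg, le_trans ?_ htail⟩
  refine integral_mono_of_nonneg (Filter.Eventually.of_forall hnonneg)
    (by rw [hind]; exact hY2.indicator hs) (Filter.Eventually.of_forall fun ω => ?_)
  dsimp only
  split_ifs with h
  · refine mul_le_of_le_one_left (sq_nonneg _) (sub_le_self _ ?_)
    exact div_nonneg (le_min (sq_nonneg _) hτ.le) (sq_nonneg _)
  · rw [min_eq_left (not_lt.1 h)]
    rcases eq_or_ne (l2norm (X ω) ^ 2) 0 with h0 | h0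
    · have hzero : (∑ j, v j * X ω j) ^ 2 = 0 := le_antisymm (h0 ▸ hle ω) (sq_nonneg _)
      simp [hzero]
    · simp [div_self h0]
end
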